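/- arXiv:1912.10947 — 2 statements merged into one kernel-verified Lean document; each statement's English description precedes it below -/
import Mathlib

section
/- Let (T(t))_{t≥0} be a C₀-semigroup on a complex Banach space X with infinitesimal generator A such that ‖T(t)v‖/t → 0 as t → ∞ for every v ∈ X, and let x ∈ X. If A has the SVEP and 0 is a pole of the local resolvent function x̂_A of A at x of order 1, then T(t) is local mean ergodic at x. -/
open Filter Topology Metric

/-- A strongly continuous one-parameter semigroup of bounded linear operators:
`T 0 = I`, `T (s+t) = T s ∘ T t` for `s,t ≥ 0`, and `t ↦ T t x` is continuous
on `[0,∞)` for every `x`. -/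
structure IsC0Semigroup {X : Type*} [NormedAddCommGroup X] [NormedSpace ℂ X]
    (T : ℝ → X →L[ℂ] X) : Prop where
  map_zero : T 0 = 1
  map_add : ∀ s t : ℝ, 0 ≤ s → 0 ≤ t → T (s + t) = T s ∘L T t
  strong_continuity : ∀ x : X, ContinuousOn (fun t : ℝ => T t x) (Set.Ici 0)

/-- `A`, with domain `D`, is the infinitesimal generator of the semigroup `T`:
`D = {x : lim_{t→0⁺} (T t x - x)/t exists}` and `A x` is that limit on `D`. -/
structure IsGenerator {X : Type*} [NormedAddCommGroup X] [NormedSpace ℂ X]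
    (T : ℝ → X →L[ℂ] X) (D : Set X) (A : X → X) : Prop where
  mem_domain_iff : ∀ x : X,
    x ∈ D ↔ ∃ y : X, Tendsto (fun t : ℝ => t⁻¹ • (T t x - x)) (𝓝[>] 0) (𝓝 y)
  tendsto_of_mem : ∀ x ∈ D,
    Tendsto (fun t : ℝ => t⁻¹ • (T t x - x)) (𝓝[>] 0) (𝓝 (A x))

/-- The Cesàro average `C(t)x = t⁻¹ ∫₀ᵗ T(s)x ds`. -/
noncomputable def cesaro {X : Type*} [NormedAddCommGroup X] [NormedSpace ℂ X]
    (T : ℝ → X →L[ℂ] X) (t : ℝ) (x : X) : X :=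
  t⁻¹ • ∫ s in (0:ℝ)..t, T s x

/-- The local resolvent set of the (possibly unbounded) operator `A` with domain `D`
at `x`: the union of all open `U ⊆ ℂ` admitting an analytic `f : U → D` with
`(A - μ)f(μ) = x` on `U`. -/
def localResolventSet {X : Type*} [NormedAddCommGroup X] [NormedSpace ℂ X]
    (D : Set X) (A : X → X) (x : X) : Set ℂ :=
  {μ | ∃ U : Set ℂ, IsOpen U ∧ μ ∈ U ∧ ∃ f : ℂ → X, AnalyticOnNhd ℂ f U ∧
      ∀ z ∈ U, f z ∈ D ∧ A (f z) - z • f z = x}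

/-- The local spectrum `σ_A(x) = ℂ \ ρ_A(x)`. -/
def localSpectrum {X : Type*} [NormedAddCommGroup X] [NormedSpace ℂ X]
    (D : Set X) (A : X → X) (x : X) : Set ℂ :=
  (localResolventSet D A x)ᶜ

/-- `A` (with domain `D`) has the single valued extension property at `μ₀`:
on every open disk centred at `μ₀`, the only analytic `f` with values in `D`
satisfying `(z - A) f z = 0` is `f ≡ 0`. -/
def HasSVEPAt {X : Type*} [NormedAddCommGroup X] [NormedSpace ℂ X]
    (D : Set X) (A : X → X) (μ₀ : ℂ) : Prop :=
  ∀ r : ℝ, 0 < r → ∀ f : ℂ → X, AnalyticOnNhd ℂ f (ball μ₀ r) →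
    (∀ z ∈ ball μ₀ r, f z ∈ D ∧ z • f z - A (f z) = 0) →
    ∀ z ∈ ball μ₀ r, f z = 0

/-- `α` is a pole of order `n` of the local resolvent function of `A` (with domain `D`)
at `x`: `α` is an isolated point of the local spectrum `σ_A(x)` and there is an
analytic function `f` near `α`, nonvanishing at `α`, such that
`(z-α)⁻ⁿ • f z` is the local resolvent function on a punctured disk around `α`
(i.e. it takes values in `D` and solves `(z - A) u = x` there). -/
def IsLocalPoleOfOrder {X : Type*} [NormedAddCommGroup X] [NormedSpace ℂ X]
    (D : Set X) (A : X → X) (x : X) (α : ℂ) (n : ℕ) : Prop :=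
  α ∉ localResolventSet D A x ∧
  ∃ r : ℝ, 0 < r ∧
    (∀ z : ℂ, z ≠ α → ‖z - α‖ < r → z ∈ localResolventSet D A x) ∧
    ∃ f : ℂ → X, AnalyticOnNhd ℂ f (ball α r) ∧ f α ≠ 0 ∧
      ∀ z ∈ ball α r, z ≠ α →
        ((z - α)⁻¹ ^ n • f z ∈ D ∧
          z • ((z - α)⁻¹ ^ n • f z) - A ((z - α)⁻¹ ^ n • f z) = x)

section

variable {X : Type*} [NormedAddCommGroup X] [NormedSpace ℂ X] {T : ℝ → X →L[ℂ] X}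

/-- The integrated form of `A u = v` for the generator `A` of the semigroup `T`:
`T t u - u = ∫₀ᵗ T s v ds` for all `t ≥ 0`. -/
def IntegratedGraph (T : ℝ → X →L[ℂ] X) (u v : X) : Prop :=
  ∀ t : ℝ, 0 ≤ t → T t u - u = ∫ s in (0:ℝ)..t, T s v

namespace IsC0Semigroup

theorem intervalIntegrable (hT : IsC0Semigroup T) (v : X) {t : ℝ} (ht : 0 ≤ t) :
    IntervalIntegrable (fun s => T s v) MeasureTheory.volume 0 t := by
  refine ((hT.strong_continuity v).mono ?_).intervalIntegrable
  rw [Set.uIcc_of_le ht]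
  exact Set.Icc_subset_Ici_self

theorem exists_norm_le [CompleteSpace X] (hT : IsC0Semigroup T) (t : ℝ) :
    ∃ C : ℝ, ∀ s ∈ Set.Icc 0 t, ‖T s‖ ≤ C := by
  obtain ⟨C, hC⟩ := banach_steinhaus (g := fun s : Set.Icc (0:ℝ) t => T s) fun v => by
    obtain ⟨C, hC⟩ := isCompact_Icc.exists_bound_of_continuousOn
      ((hT.strong_continuity v).mono (Set.Icc_subset_Ici_self : Set.Icc 0 t ⊆ Set.Ici 0))
    exact ⟨C, fun s => hC s s.2⟩
  exact ⟨C, fun s hs => hC ⟨s, hs⟩⟩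

theorem hasDerivWithinAt (hT : IsC0Semigroup T) {u v : X}
    (h : Tendsto (fun t : ℝ => t⁻¹ • (T t u - u)) (𝓝[>] 0) (𝓝 v)) {t : ℝ} (ht : 0 ≤ t) :
    HasDerivWithinAt (fun s => T s u) (T t v) (Set.Ioi t) t := by
  rw [hasDerivWithinAt_iff_tendsto_slope' Set.self_notMem_Ioi]
  have hshift : Tendsto (fun s : ℝ => s - t) (𝓝[>] t) (𝓝[>] 0) := by
    refine tendsto_nhdsWithin_iff.2 ⟨?_, ?_⟩
    · have : Tendsto (fun s : ℝ => s - t) (𝓝 t) (𝓝 (t - t)) :=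
        (continuous_id.sub continuous_const).tendsto t
      rw [sub_self] at this
      exact this.mono_left nhdsWithin_le_nhds
    · filter_upwards [self_mem_nhdsWithin] with s hs
      exact sub_pos.2 (Set.mem_Ioi.1 hs)
  refine (((T t).continuous.tendsto v).comp (h.comp hshift)).congr' ?_
  filter_upwards [self_mem_nhdsWithin] with s hs
  have hadd : T s = T t ∘L T (s - t) := by
    rw [← hT.map_add t (s - t) ht (sub_nonneg.2 (le_of_lt hs)), add_sub_cancel]
  have hmap : T t ((s - t)⁻¹ • (T (s - t) u - u)) = (s - t)⁻¹ • T t (T (s - t) u - u) :=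
    map_real_smul (T t) (T t).continuous _ _
  simp only [Function.comp_apply, slope_def_module, hmap, map_sub]
  rw [hadd, ContinuousLinearMap.comp_apply]

theorem integratedGraph_of_tendsto [CompleteSpace X] (hT : IsC0Semigroup T) {u v : X}
    (h : Tendsto (fun t : ℝ => t⁻¹ • (T t u - u)) (𝓝[>] 0) (𝓝 v)) :
    IntegratedGraph T u v := by
  intro t ht
  have hcont : ContinuousOn (fun s => T s u) (Set.uIcc 0 t) :=
    (hT.strong_continuity u).mono (by
      rw [Set.uIcc_of_le ht]
      exact Set.Icc_subset_Ici_self)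
  rw [intervalIntegral.integral_eq_sub_of_hasDeriv_right hcont
    (fun s hs => hT.hasDerivWithinAt h (by
      rw [min_eq_left ht] at hs
      exact hs.1.le)) (hT.intervalIntegrable v ht), hT.map_zero]
  rfl

theorem tendsto_integral [CompleteSpace X] (hT : IsC0Semigroup T) {ι : Type*} {l : Filter ι}
    {v : ι → X} {v₀ : X} (hv : Tendsto v l (𝓝 v₀)) {t : ℝ} (ht : 0 ≤ t) :
    Tendsto (fun i => ∫ s in (0:ℝ)..t, T s (v i)) l (𝓝 (∫ s in (0:ℝ)..t, T s v₀)) := by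
  obtain ⟨C, hC⟩ := hT.exists_norm_le t
  rw [tendsto_iff_norm_sub_tendsto_zero] at hv ⊢
  refine squeeze_zero (g := fun i => C * ‖v i - v₀‖ * |t - 0|) (fun _ => norm_nonneg _)
    (fun i => ?_) ?_
  · rw [← intervalIntegral.integral_sub (hT.intervalIntegrable _ ht)
      (hT.intervalIntegrable _ ht)]
    refine intervalIntegral.norm_integral_le_of_norm_le_const fun s hs => ?_
    rw [Set.uIoc_of_le ht] at hs
    rw [← map_sub]
    exact (T s).le_of_opNorm_le (hC s ⟨hs.1.le, hs.2⟩) _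
  · simpa using (hv.const_mul C).mul_const |t - 0|

end IsC0Semigroup

namespace IntegratedGraph

theorem smul {u v : X} (h : IntegratedGraph T u v) (c : ℂ) :
    IntegratedGraph T (c • u) (c • v) := by
  intro t ht
  simp only [map_smul, ← smul_sub, h t ht, intervalIntegral.integral_smul]

theorem sub (hT : IsC0Semigroup T) {u v u' v' : X} (h : IntegratedGraph T u v)
    (h' : IntegratedGraph T u' v') : IntegratedGraph T (u - u') (v - v') := by
  intro t ht
  simp only [map_sub]
  rw [intervalIntegral.integral_sub (hT.intervalIntegrable v ht) (hT.intervalIntegrable v' ht),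
    ← h t ht, ← h' t ht]
  abel

theorem of_tendsto [CompleteSpace X] (hT : IsC0Semigroup T) {ι : Type*} {l : Filter ι}
    [l.NeBot] {u v : ι → X} {u₀ v₀ : X} (hu : Tendsto u l (𝓝 u₀)) (hv : Tendsto v l (𝓝 v₀))
    (h : ∀ᶠ i in l, IntegratedGraph T (u i) (v i)) : IntegratedGraph T u₀ v₀ := by
  intro t ht
  refine tendsto_nhds_unique ((((T t).continuous.tendsto u₀).comp hu).sub hu)
    ((hT.tendsto_integral hv ht).congr' ?_)
  filter_upwards [h] with i hi
  exact (hi t ht).symm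

end IntegratedGraph

/-- A semigroup with `‖T t v‖ = o(t)` is mean ergodic at `x` when `x` is a fixed vector up to an
element of the range of the generator. -/
theorem tendsto_cesaro_of_integratedGraph [CompleteSpace X] (hT : IsC0Semigroup T)
    (hgrowth : ∀ v : X, Tendsto (fun t : ℝ => ‖T t v‖ / t) atTop (𝓝 0)) {x y w : X}
    (hy : IntegratedGraph T y 0) (hw : IntegratedGraph T w (y - x)) :
    Tendsto (fun t : ℝ => cesaro T t x) atTop (𝓝 y) := by
  have hTw : Tendsto (fun t : ℝ => t⁻¹ • T t w) atTop (𝓝 0) := by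
    refine squeeze_zero_norm' ?_ (hgrowth w)
    filter_upwards [eventually_gt_atTop 0] with t ht
    rw [norm_smul, norm_inv, Real.norm_of_nonneg ht.le, div_eq_inv_mul]
  have hlim : Tendsto (fun t : ℝ => y - (t⁻¹ • T t w - t⁻¹ • w)) atTop (𝓝 y) := by
    simpa using tendsto_const_nhds.sub (hTw.sub (tendsto_inv_atTop_zero.smul_const w))
  refine hlim.congr' ?_
  filter_upwards [eventually_gt_atTop 0] with t ht
  have hfix : Set.EqOn (fun s => T s y) (fun _ => y) (Set.uIcc 0 t) := by
    intro s hs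
    rw [Set.uIcc_of_le ht.le] at hs
    simpa [sub_eq_zero] using hy s hs.1
  have hint := hw t ht.le
  simp only [map_sub] at hint
  rw [intervalIntegral.integral_sub (hT.intervalIntegrable y ht.le)
    (hT.intervalIntegrable x ht.le), intervalIntegral.integral_congr hfix,
    intervalIntegral.integral_const, sub_zero] at hint
  rw [cesaro, ← smul_sub, hint, smul_sub, inv_smul_smul₀ ht.ne', sub_sub_cancel]

end

/-- If `‖T(t)v‖/t → 0` for every `v`, `A` has the SVEP, and `0` is a pole of order `1` of
the local resolvent function of `A` at `x`, then `T(t)` is local mean ergodic at `x`. -/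
theorem localMeanErgodic_of_pole_order_one
    {X : Type*} [NormedAddCommGroup X] [NormedSpace ℂ X] [CompleteSpace X]
    (T : ℝ → X →L[ℂ] X) (D : Set X) (A : X → X)
    (hT : IsC0Semigroup T) (hA : IsGenerator T D A)
    (hgrowth : ∀ v : X, Tendsto (fun t : ℝ => ‖T t v‖ / t) atTop (𝓝 0))
    (hSVEP : ∀ μ : ℂ, HasSVEPAt D A μ) (x : X)
    (hpole : IsLocalPoleOfOrder D A x 0 1) :
    ∃ y : X, Tendsto (fun t : ℝ => cesaro T t x) atTop (𝓝 y) := by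
  obtain ⟨-, r, hr, -, f, hf, -, hres⟩ := hpole
  have hfd : HasDerivAt f (deriv f 0) 0 :=
    (hf 0 (mem_ball_self hr)).differentiableAt.hasDerivAt
  have hf0 : Tendsto f (𝓝[≠] 0) (𝓝 (f 0)) :=
    hfd.continuousAt.tendsto.mono_left nhdsWithin_le_nhds
  have hz : Tendsto (fun z : ℂ => z) (𝓝[≠] 0) (𝓝 0) :=
    tendsto_id.mono_left nhdsWithin_le_nhds
  have hball : ∀ᶠ z : ℂ in 𝓝[≠] 0, z ∈ ball (0:ℂ) r ∧ z ≠ 0 :=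
    (eventually_nhdsWithin_of_eventually_nhds (ball_mem_nhds _ hr)).and self_mem_nhdsWithin
  have hgraph : ∀ z ∈ ball (0:ℂ) r, z ≠ 0 → IntegratedGraph T (f z) (z • (f z - x)) := by
    intro z hzr hz0
    obtain ⟨hD, heq⟩ := hres z hzr hz0
    have h := (hT.integratedGraph_of_tendsto (hA.tendsto_of_mem _ hD)).smul z
    rw [sub_eq_iff_eq_add, ← sub_eq_iff_eq_add'] at heq
    rw [← heq] at h
    simpa [smul_inv_smul₀ hz0] using h
  have hfix : IntegratedGraph T (f 0) 0 :=
    .of_tendsto hT hf0 (by simpa using hz.smul (hf0.sub_const x))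
      (hball.mono fun z h => hgraph z h.1 h.2)
  have hderiv : IntegratedGraph T (deriv f 0) (f 0 - x) := by
    refine .of_tendsto hT hfd.tendsto_slope (hf0.sub_const x) ?_
    filter_upwards [hball] with z h
    have := ((hgraph z h.1 h.2).sub hT hfix).smul z⁻¹
    rw [slope_def_module, sub_zero]
    rwa [sub_zero, inv_smul_smul₀ h.2] at this
  exact ⟨f 0, tendsto_cesaro_of_integratedGraph hT hgrowth hfix hderiv⟩
end

section
/- Let (T(t))_{t≥0} be a C₀-semigroup on a complex Banach space X with infinitesimal generator A, and let x ∈ X satisfy ‖T(t)x‖/t → 0 as t → ∞. Suppose A has the SVEP and that the local spectral radius satisfies r_{T(t)}(x) < 1 for every t > 0. Then T(t) is local mean ergodic at x, with lim_{t→∞} C(t)x = 0. -/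
open Filter Topology Metric

/-- The local spectral radius `r_A(x) = sup {‖z‖ : z ∈ σ_A(x)}`. -/
noncomputable def localSpectralRadius {X : Type*} [NormedAddCommGroup X] [NormedSpace ℂ X]
    (D : Set X) (A : X → X) (x : X) : ℝ :=
  sSup (norm '' localSpectrum D A x)

section LocalSpectralTheory

variable {X : Type*} [NormedAddCommGroup X] [NormedSpace ℂ X] [CompleteSpace X]

theorem norm_le_of_mem_localSpectrum (S : X →L[ℂ] X) (x : X) {z : ℂ}
    (hz : z ∈ localSpectrum (Set.univ : Set X) (fun v => S v) x) :
    ‖z‖ ≤ ‖S‖ * ‖(1 : X →L[ℂ] X)‖ := by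
  by_contra! hlt
  refine hz ⟨resolventSet ℂ S, spectrum.isOpen_resolventSet S,
    spectrum.mem_resolventSet_of_norm_lt_mul hlt, fun w => -(resolvent S w x), ?_, ?_⟩
  · have hd : DifferentiableOn ℂ (fun w => -(resolvent S w x)) (resolventSet ℂ S) := by
      intro w hw
      have h := (spectrum.hasDerivAt_resolvent_const_left hw).differentiableAt
      exact ((h.clm_apply (differentiableAt_const x)).neg).differentiableWithinAt
    exact hd.analyticOnNhd (spectrum.isOpen_resolventSet S)
  · intro w hw
    refine ⟨Set.mem_univ _, ?_⟩
    have h := Ring.mul_inverse_cancel _ (spectrum.mem_resolventSet_iff.1 hw)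
    have h' := congrArg (fun L : X →L[ℂ] X => L x) h
    simp only [resolvent]
    simp [Algebra.algebraMap_eq_smul_one] at h' ⊢
    conv_rhs => rw [← h']
    abel

theorem mem_localResolventSet_of_localSpectralRadius_lt_norm (S : X →L[ℂ] X) (x : X) {z : ℂ}
    (hz : localSpectralRadius (Set.univ : Set X) (fun v => S v) x < ‖z‖) :
    z ∈ localResolventSet (Set.univ : Set X) (fun v => S v) x := by
  by_contra hmem
  refine hz.not_ge (le_csSup ⟨‖S‖ * ‖(1 : X →L[ℂ] X)‖, ?_⟩ ⟨z, hmem, rfl⟩)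
  rintro _ ⟨w, hw, rfl⟩
  exact norm_le_of_mem_localSpectrum S x hw

/-- Local solutions of `(1 - w S) g = x` around the points of a closed disk which are unique
near each point glue to the Neumann series `∑ wⁿ Sⁿ x`, which therefore converges there. -/
theorem summable_pow_smul_apply_of_local_solutions (S : X →L[ℂ] X) (x : X) (s : ℝ)
    {R : NNReal} (hR : 0 < R) (hsR : s * R < 1) (hs : 0 ≤ s)
    (hex : ∀ w : ℂ, s * ‖w‖ < 1 → ∃ g : ℂ → X, AnalyticAt ℂ g w ∧
      ∀ᶠ v in 𝓝 w, g v - v • S (g v) = x)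
    (huniq : ∀ (v : ℂ) (h : ℂ → X), AnalyticAt ℂ h v → (∀ᶠ u in 𝓝 v, h u = u • S (h u)) →
      h v = 0) (w : ℂ) (hw : ‖w‖ < R) : Summable fun n : ℕ => w ^ n • (S ^ n) x := by
  choose! g hga hge using hex
  have hopen : ∀ w : ℂ, s * ‖w‖ < 1 → ∀ᶠ v : ℂ in 𝓝 w, s * ‖v‖ < 1 := fun w hw =>
    (show Continuous fun v : ℂ => s * ‖v‖ by fun_prop).continuousAt.eventually_lt
      continuousAt_const hw
  have hGg : ∀ w : ℂ, s * ‖w‖ < 1 → (fun v => g v v) =ᶠ[𝓝 w] g w := by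
    intro w hw
    filter_upwards [hopen w hw, (hga w hw).eventually_analyticAt,
      (hge w hw).eventually_nhds] with v hv hav hev
    refine sub_eq_zero.1 (huniq v (fun u => g v u - g w u) ((hga v hv).sub hav) ?_)
    filter_upwards [hev, hge v hv] with u h1 h2
    rw [map_sub, smul_sub, sub_eq_sub_iff_sub_eq_sub, h2, h1]
  have hbound : ∀ w ∈ closedBall (0 : ℂ) R, s * ‖w‖ < 1 := by
    intro w hw
    rw [mem_closedBall_zero_iff] at hw
    exact (mul_le_mul_of_nonneg_left hw hs).trans_lt hsR
  have hd : DifferentiableOn ℂ (fun v => g v v) (closedBall 0 R) := fun w hw =>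
    have hG := (hga w (hbound w hw)).congr (hGg w (hbound w hw)).symm
    hG.differentiableAt.differentiableWithinAt
  have hps := hd.hasFPowerSeriesOnBall hR
  have hneu := (ContinuousLinearMap.apply ℂ X x).comp_hasFPowerSeriesOnBall
    (spectrum.hasFPowerSeriesOnBall_inverse_one_sub_smul ℂ S)
  have heq : (⇑(ContinuousLinearMap.apply ℂ X x) ∘ fun z : ℂ => Ring.inverse (1 - z • S))
      =ᶠ[𝓝 0] fun v => g v v := by
    have hunit : ∀ᶠ v : ℂ in 𝓝 0, ‖v • S‖ < 1 :=
      (show Continuous fun v : ℂ => ‖v • S‖ by fun_prop).continuousAt.eventually_lt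
        continuousAt_const (by simp)
    have h0 : s * ‖(0 : ℂ)‖ < 1 := by simp
    filter_upwards [hunit, hopen 0 h0] with v hv hsv
    have h := Ring.inverse_mul_cancel _ (isUnit_one_sub_of_norm_lt_one hv)
    have h' := congrArg (fun L : X →L[ℂ] X => L (g v v)) h
    have h2 := (hge v hsv).self_of_nhds
    simp [h2] at h' ⊢
    exact h'
  have hp := (hneu.hasFPowerSeriesAt.congr heq).eq_formalMultilinearSeries hps.hasFPowerSeriesAt
  rw [← hp] at hps
  have hw' : w ∈ Metric.eball (0 : ℂ) R := by
    simpa [Metric.mem_eball, edist_zero_right, enorm] using hw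
  refine (hps.hasSum hw').summable.congr fun n => ?_
  change (ContinuousMultilinearMap.mkPiRing ℂ (Fin n) (S ^ n) fun _ => w) x = _
  rw [ContinuousMultilinearMap.mkPiRing_apply]
  simp

theorem summable_pow_apply_of_localSpectralRadius_lt_one (S : X →L[ℂ] X) (x : X)
    (hrad : localSpectralRadius (Set.univ : Set X) (fun v => S v) x < 1)
    (huniq : ∀ (v : ℂ) (h : ℂ → X), AnalyticAt ℂ h v → (∀ᶠ u in 𝓝 v, h u = u • S (h u)) →
      h v = 0) : Summable fun n : ℕ => (S ^ n) x := by
  obtain ⟨s, hs, hs1⟩ : ∃ s, localSpectralRadius (Set.univ : Set X) (fun v => S v) x ≤ s ∧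
      0 ≤ s ∧ s < 1 := ⟨max _ 0, le_max_left _ _, le_max_right _ _, max_lt hrad one_pos⟩
  obtain ⟨hs0, hs1⟩ := hs1
  have hR : (0 : ℝ) < 2 / (1 + s) := by positivity
  have h := summable_pow_smul_apply_of_local_solutions S x s (R := ⟨2 / (1 + s), hR.le⟩) hR
    (by
      change s * (2 / (1 + s)) < 1
      rw [← mul_div_assoc, div_lt_one (by positivity)]
      linarith) hs0 ?_ huniq 1 (by
      change ‖(1 : ℂ)‖ < 2 / (1 + s)
      rw [norm_one, lt_div_iff₀ (by positivity)]
      linarith)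
  · simpa using h
  intro w hw
  rcases eq_or_ne w 0 with rfl | hw0
  · refine ⟨fun v => Ring.inverse (1 - v • S) x, ?_, ?_⟩
    · exact ((ContinuousLinearMap.apply ℂ X x).comp_hasFPowerSeriesOnBall
        (spectrum.hasFPowerSeriesOnBall_inverse_one_sub_smul ℂ S)).analyticAt
    · have hunit : ∀ᶠ v : ℂ in 𝓝 0, ‖v • S‖ < 1 :=
        (show Continuous fun v : ℂ => ‖v • S‖ by fun_prop).continuousAt.eventually_lt
          continuousAt_const (by simp)
      filter_upwards [hunit] with v hv
      have h := Ring.mul_inverse_cancel _ (isUnit_one_sub_of_norm_lt_one hv)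
      simpa using congrArg (fun L : X →L[ℂ] X => L x) h
  · have hz : s < ‖w⁻¹‖ := by
      rw [norm_inv, ← one_div, lt_div_iff₀ (norm_pos_iff.2 hw0)]
      exact hw
    obtain ⟨U, hU, hwU, f, hf, hfe⟩ :=
      mem_localResolventSet_of_localSpectralRadius_lt_norm S x (hs.trans_lt hz)
    have hinv : AnalyticAt ℂ (fun v : ℂ => v⁻¹) w := analyticAt_inv hw0
    refine ⟨fun v => -(v⁻¹ • f v⁻¹), ?_, ?_⟩
    · have hc : AnalyticAt ℂ (fun v : ℂ => f v⁻¹) w := (hf _ hwU).fun_comp hinv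
      exact (hinv.smul hc).neg
    · filter_upwards [hinv.continuousAt.preimage_mem_nhds (hU.mem_nhds hwU),
        eventually_ne_nhds hw0] with v hv hv0
      have h := (hfe _ hv).2
      simp only [map_neg, map_smul, smul_neg, smul_smul, mul_inv_cancel₀ hv0, one_smul]
      rw [← h]
      abel

end LocalSpectralTheory

/-- A continuous function on `[0, 1]` with equal end values and vanishing Fourier coefficients
vanishes at `0`. -/
theorem eq_zero_of_fourier_integrals_eq_zero {X : Type*} [NormedAddCommGroup X] [NormedSpace ℂ X]
    [CompleteSpace X] {φ : ℝ → X} (hφ : ContinuousOn φ (Set.Icc 0 1)) (hper : φ 0 = φ 1)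
    (hint : ∀ n : ℤ, ∫ s in (0 : ℝ)..1,
      Complex.exp (2 * Real.pi * Complex.I * n * s) • φ s = 0) : φ 0 = 0 := by
  rw [SeparatingDual.eq_zero_iff_forall_dual_eq_zero (R := ℂ)]
  intro ℓ
  have : Fact ((0 : ℝ) < 1) := ⟨one_pos⟩
  set ψ : ℝ → ℂ := fun s => ℓ (φ s) with hψdef
  have hψ : ContinuousOn ψ (Set.Icc 0 (0 + 1)) := by
    rw [zero_add]
    exact ℓ.continuous.comp_continuousOn hφ
  have hcont : Continuous (AddCircle.liftIco 1 0 ψ) :=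
    AddCircle.liftIco_continuous (by simp [hψdef, hper]) hψ
  have hcoeff : ∀ n : ℤ, fourierCoeff (AddCircle.liftIco 1 0 ψ) n = 0 := by
    intro n
    rw [fourierCoeff_liftIco_eq, fourierCoeffOn_eq_integral]
    have hI : IntervalIntegrable
        (fun s : ℝ => Complex.exp (2 * Real.pi * Complex.I * ((-n : ℤ) : ℂ) * s) • φ s)
        MeasureTheory.volume 0 1 := by
      apply ContinuousOn.intervalIntegrable
      rw [Set.uIcc_of_le zero_le_one]
      exact ContinuousOn.smul (by fun_prop) hφ
    have h := ℓ.intervalIntegral_comp_comm hI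
    rw [hint, map_zero] at h
    simp only [fourier_coe_apply]
    simp only [map_smul] at h
    simpa [hψdef] using h
  have h := has_pointwise_sum_fourier_series_of_summable (f := ⟨_, hcont⟩)
    (by simp [funext hcoeff]) ((0 : ℝ) : AddCircle (1 : ℝ))
  simp only [ContinuousMap.coe_mk, hcoeff, zero_smul] at h
  rw [AddCircle.liftIco_coe_apply (by simp)] at h
  exact h.unique hasSum_zero

theorem tendsto_inv_smul_integral_of_tendsto_zero {E : Type*} [NormedAddCommGroup E]
    [NormedSpace ℝ E] {f : ℝ → E} (hf : ContinuousOn f (Set.Ici 0))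
    (hlim : Tendsto f atTop (𝓝 0)) :
    Tendsto (fun t : ℝ => t⁻¹ • ∫ s in (0 : ℝ)..t, f s) atTop (𝓝 0) := by
  have hI : ∀ a b : ℝ, 0 ≤ a → 0 ≤ b → IntervalIntegrable f MeasureTheory.volume a b := by
    intro a b ha hb
    refine (hf.mono fun s hs => ?_).intervalIntegrable
    exact (le_inf ha hb).trans hs.1
  rw [Metric.tendsto_atTop]
  intro ε hε
  obtain ⟨t₀, ht₀⟩ := Metric.tendsto_atTop.1 hlim (ε / 2) (half_pos hε)
  set a := max t₀ 0
  set K := ‖∫ s in (0 : ℝ)..a, f s‖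
  refine ⟨max (a + 1) (2 * K / ε + 1), fun t ht => ?_⟩
  have hat : a < t := by linarith [le_max_left (a + 1) (2 * K / ε + 1)]
  have ha : 0 ≤ a := le_max_right _ _
  have ht0 : 0 < t := ha.trans_lt hat
  have hKt : 2 * K < t * ε := by
    rw [← div_lt_iff₀ hε]
    linarith [le_max_right (a + 1) (2 * K / ε + 1)]
  have htail : ‖∫ s in a..t, f s‖ ≤ ε / 2 * |t - a| := by
    refine intervalIntegral.norm_integral_le_of_norm_le_const fun s hs => ?_
    rw [Set.uIoc_of_le hat.le] at hs
    have := ht₀ s ((le_max_left _ _).trans hs.1.le)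
    rw [dist_zero_right] at this
    exact this.le
  rw [dist_zero_right, norm_smul, norm_inv, Real.norm_of_nonneg ht0.le, inv_mul_lt_iff₀ ht0,
    ← intervalIntegral.integral_add_adjacent_intervals (hI 0 a le_rfl ha) (hI a t ha ht0.le)]
  rw [abs_of_pos (sub_pos.2 hat)] at htail
  have := norm_add_le (∫ s in (0 : ℝ)..a, f s) (∫ s in a..t, f s)
  have hε' : 0 ≤ ε / 2 * a := by positivity
  change _ ≤ K + _ at this
  linarith

section Semigroup

variable {X : Type*} [NormedAddCommGroup X] [NormedSpace ℂ X] {T : ℝ → X →L[ℂ] X}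

theorem IsC0Semigroup.exists_norm_le_s16 [CompleteSpace X] (hT : IsC0Semigroup T) :
    ∃ M : ℝ, 0 ≤ M ∧ ∀ s ∈ Set.Icc (0 : ℝ) 1, ‖T s‖ ≤ M := by
  obtain ⟨M, hM⟩ := banach_steinhaus (g := fun s : Set.Icc (0 : ℝ) 1 => T s) fun y => by
    obtain ⟨C, hC⟩ := isCompact_Icc.exists_bound_of_continuousOn
      ((hT.strong_continuity y).mono (Set.Icc_subset_Ici_self (b := (0 : ℝ)) (a := 1)))
    exact ⟨C, fun s => hC s s.2⟩
  exact ⟨M, (norm_nonneg _).trans (hM ⟨0, by simp⟩), fun s hs => hM ⟨s, hs⟩⟩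

theorem IsC0Semigroup.pow_eq (hT : IsC0Semigroup T) (n : ℕ) : T 1 ^ n = T n := by
  induction n with
  | zero => simp [hT.map_zero]
  | succ n ih =>
    rw [pow_succ, ih, Nat.cast_succ, hT.map_add n 1 n.cast_nonneg zero_le_one]
    rfl

theorem IsC0Semigroup.tendsto_of_tendsto_pow [CompleteSpace X] (hT : IsC0Semigroup T) {x : X}
    (h : Tendsto (fun n : ℕ => (T 1 ^ n) x) atTop (𝓝 0)) :
    Tendsto (fun t : ℝ => T t x) atTop (𝓝 0) := by
  obtain ⟨M, -, hM⟩ := hT.exists_norm_le_s16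
  have h1 : Tendsto (fun t : ℝ => M * ‖(T 1 ^ ⌊t⌋₊) x‖) atTop (𝓝 0) := by
    simpa using ((h.comp tendsto_nat_floor_atTop).norm).const_mul M
  refine squeeze_zero_norm' ?_ h1
  filter_upwards [eventually_ge_atTop 0] with t ht
  have hfl := Nat.floor_le ht
  have hlt := Nat.lt_floor_add_one t
  have : T t x = T (t - ⌊t⌋₊) ((T 1 ^ ⌊t⌋₊) x) := by
    rw [hT.pow_eq]
    nth_rewrite 1 [show t = (t - ⌊t⌋₊) + ⌊t⌋₊ by ring]
    rw [hT.map_add _ _ (by linarith) (Nat.cast_nonneg _)]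
    rfl
  rw [this]
  exact (T (t - ⌊t⌋₊)).le_of_opNorm_le (hM _ ⟨by linarith, by linarith⟩) _

/-- The `exp (-z s)`-weighted orbit integral of `y` over one unit of time. -/
noncomputable def expOrbitIntegral (T : ℝ → X →L[ℂ] X) (z : ℂ) (y : X) : X :=
  ∫ s in (0 : ℝ)..1, Complex.exp (-z * s) • T s y

theorem IsC0Semigroup.continuousOn_exp_smul (hT : IsC0Semigroup T) (z : ℂ) (y : X) :
    ContinuousOn (fun s : ℝ => Complex.exp (-z * s) • T s y) (Set.Ici 0) :=
  ContinuousOn.smul (by fun_prop) (hT.strong_continuity y)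

theorem IsC0Semigroup.map_expOrbitIntegral [CompleteSpace X] (hT : IsC0Semigroup T) {z : ℂ} {y : X}
    (hy : Complex.exp (-z) • T 1 y = y) {h : ℝ} (hh : 0 ≤ h) :
    T h (expOrbitIntegral T z y) = Complex.exp (z * h) • expOrbitIntegral T z y := by
  set φ : ℝ → X := fun s => Complex.exp (-z * s) • T s y with hφ
  have hI : ∀ a b : ℝ, 0 ≤ a → 0 ≤ b → IntervalIntegrable φ MeasureTheory.volume a b := by
    intro a b ha hb
    refine ((hT.continuousOn_exp_smul z y).mono fun s hs => ?_).intervalIntegrable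
    exact (le_inf ha hb).trans hs.1
  have hper : ∀ s : ℝ, 0 ≤ s → φ (s + 1) = φ s := by
    intro s hs
    simp only [hφ, hT.map_add s 1 hs zero_le_one, ContinuousLinearMap.comp_apply]
    conv_rhs => rw [← hy]
    rw [map_smul, smul_smul, ← Complex.exp_add]
    congr 2
    push_cast
    ring
  have hshift : ∫ s in (0 : ℝ)..1, φ (s + h) = ∫ s in (0 : ℝ)..1, φ s := by
    have h1 : ∫ s in (1 : ℝ)..(1 + h), φ s = ∫ s in (0 : ℝ)..h, φ s := by
      have := intervalIntegral.integral_comp_add_right (a := 0) (b := h) φ 1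
      rw [zero_add, add_comm h 1] at this
      rw [← this]
      refine intervalIntegral.integral_congr fun s hs => hper s ?_
      rw [Set.uIcc_of_le hh] at hs
      exact hs.1
    rw [intervalIntegral.integral_comp_add_right, zero_add, ← sub_eq_zero,
      intervalIntegral.integral_interval_sub_interval_comm (hI _ _ hh (by linarith))
        (hI _ _ le_rfl zero_le_one) (hI _ _ hh le_rfl), intervalIntegral.integral_symm,
      intervalIntegral.integral_symm 1, h1]
    simp
  rw [expOrbitIntegral, ← (T h).intervalIntegral_comp_comm (hI 0 1 le_rfl zero_le_one), ← hshift,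
    ← intervalIntegral.integral_smul]
  refine intervalIntegral.integral_congr fun s hs => ?_
  rw [Set.uIcc_of_le zero_le_one] at hs
  simp only [hφ, map_smul, smul_smul, ← Complex.exp_add]
  rw [add_comm s h, hT.map_add h s hh hs.1]
  congr 2
  push_cast
  ring

theorem IsGenerator.mem_and_eq_smul {D : Set X} {A : X → X} (hA : IsGenerator T D A) {z : ℂ} {k : X}
    (hk : ∀ h : ℝ, 0 ≤ h → T h k = Complex.exp (z * h) • k) : k ∈ D ∧ A k = z • k := by
  have hder : HasDerivAt (fun h : ℝ => Complex.exp (z * h) • k) (z • k) 0 := by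
    have h1 : HasDerivAt (fun h : ℝ => Complex.exp (z * h)) z 0 := by
      have := ((Complex.ofRealCLM.hasDerivAt (x := (0 : ℝ))).const_mul z).cexp
      simpa using this
    exact h1.smul_const k
  have hlim : Tendsto (fun t : ℝ => t⁻¹ • (T t k - k)) (𝓝[>] 0) (𝓝 (z • k)) := by
    have h2 := (hasDerivAt_iff_tendsto_slope_zero.1 hder).mono_left
      (nhdsWithin_mono _ fun t (ht : 0 < t) => ht.ne')
    refine h2.congr' ?_
    filter_upwards [self_mem_nhdsWithin] with t ht
    rw [hk t (le_of_lt ht)]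
    simp
  have hD : k ∈ D := (hA.mem_domain_iff k).2 ⟨_, hlim⟩
  exact ⟨hD, tendsto_nhds_unique (hA.tendsto_of_mem k hD) hlim⟩

theorem IsC0Semigroup.analyticOnNhd_expOrbitIntegral [CompleteSpace X] (hT : IsC0Semigroup T)
    {U : Set ℂ} (hU : IsOpen U) {y : ℂ → X} (hy : AnalyticOnNhd ℂ y U) :
    AnalyticOnNhd ℂ (fun z => expOrbitIntegral T z (y z)) U := by
  refine DifferentiableOn.analyticOnNhd (fun z₀ hz₀ => ?_) hU
  obtain ⟨M, hM0, hM⟩ := hT.exists_norm_le_s16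
  obtain ⟨r, hr, hrU⟩ := Metric.nhds_basis_closedBall.mem_iff.1 (hU.mem_nhds hz₀)
  have hcy : ContinuousOn y (closedBall z₀ r) := hy.continuousOn.mono hrU
  have hcy' : ContinuousOn (deriv y) (closedBall z₀ r) := hy.deriv.continuousOn.mono hrU
  have hcompact := (isCompact_closedBall z₀ r).prod (isCompact_Icc (a := (0 : ℝ)) (b := 1))
  obtain ⟨C, hC⟩ := hcompact.exists_bound_of_continuousOn
    (f := fun p : ℂ × ℝ => Complex.exp (-p.1 * p.2) • (deriv y p.1 - (p.2 : ℂ) • y p.1)) (by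
      have h1 : ContinuousOn (fun p : ℂ × ℝ => y p.1) (closedBall z₀ r ×ˢ Set.Icc 0 1) :=
        hcy.comp continuousOn_fst fun p hp => hp.1
      have h2 : ContinuousOn (fun p : ℂ × ℝ => deriv y p.1) (closedBall z₀ r ×ˢ Set.Icc 0 1) :=
        hcy'.comp continuousOn_fst fun p hp => hp.1
      refine ContinuousOn.smul (by fun_prop) (h2.sub (ContinuousOn.smul (by fun_prop) h1)))
  have hmeas : ∀ f : ℝ → X, ContinuousOn f (Set.Ici 0) → MeasureTheory.AEStronglyMeasurable f
      (MeasureTheory.volume.restrict (Set.uIoc 0 1)) := by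
    intro f hf
    rw [Set.uIoc_of_le zero_le_one]
    exact (hf.mono fun s hs => hs.1.le).aestronglyMeasurable measurableSet_Ioc
  have hcont' : ContinuousOn (fun s : ℝ =>
      T s (Complex.exp (-z₀ * s) • (deriv y z₀ - (s : ℂ) • y z₀))) (Set.Ici 0) := by
    simp only [map_smul, map_sub]
    exact ContinuousOn.smul (by fun_prop) ((hT.strong_continuity _).sub
      (ContinuousOn.smul (by fun_prop) (hT.strong_continuity _)))
  have key := intervalIntegral.hasDerivAt_integral_of_dominated_loc_of_deriv_le
    (μ := MeasureTheory.volume) (a := 0) (b := 1) (x₀ := z₀) (s := closedBall z₀ r)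
    (bound := fun _ => M * C)
    (F := fun z (s : ℝ) => Complex.exp (-z * s) • T s (y z))
    (F' := fun z (s : ℝ) => T s (Complex.exp (-z * s) • (deriv y z - (s : ℂ) • y z)))
    (closedBall_mem_nhds z₀ hr)
    (Eventually.of_forall fun z => hmeas _ (hT.continuousOn_exp_smul z (y z)))
    (((hT.continuousOn_exp_smul z₀ (y z₀)).mono (by
      rw [Set.uIcc_of_le zero_le_one]; exact Set.Icc_subset_Ici_self)).intervalIntegrable)
    (hmeas _ hcont')
    (Eventually.of_forall fun s hs z hz => by
      rw [Set.uIoc_of_le zero_le_one] at hs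
      have hs' : s ∈ Set.Icc (0 : ℝ) 1 := ⟨hs.1.le, hs.2⟩
      exact ((T s).le_of_opNorm_le (hM s hs') _).trans
        (mul_le_mul_of_nonneg_left (hC (z, s) ⟨hz, hs'⟩) hM0))
    intervalIntegrable_const
    (Eventually.of_forall fun s hs z hz => by
      have h1 : HasDerivAt (fun z : ℂ => Complex.exp (-z * s)) (Complex.exp (-z * s) * -s) z := by
        simpa using (((hasDerivAt_id z).neg).mul_const (s : ℂ)).cexp
      have h2 : HasDerivAt y (deriv y z) z := (hy z (hrU hz)).differentiableAt.hasDerivAt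
      have h3 := (T s).hasFDerivAt.comp_hasDerivAt z (h1.smul h2)
      refine HasDerivAt.congr_deriv (h3.congr_of_eventuallyEq ?_) ?_
      · exact Eventually.of_forall fun w => by simp
      · congr 1
        rw [smul_sub, smul_smul, sub_eq_add_neg, ← neg_smul, mul_neg])
  exact key.2.differentiableAt.differentiableWithinAt

/-- The single valued extension property of the generator passes to `T 1` away from `0`. -/
theorem IsC0Semigroup.eq_zero_of_eventually_eq_smul [CompleteSpace X] (hT : IsC0Semigroup T)
    {D : Set X} {A : X → X} (hA : IsGenerator T D A) (hSVEP : ∀ μ : ℂ, HasSVEPAt D A μ)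
    (v : ℂ) (h : ℂ → X) (hh : AnalyticAt ℂ h v) (heq : ∀ᶠ u in 𝓝 v, h u = u • T 1 (h u)) :
    h v = 0 := by
  rcases eq_or_ne v 0 with rfl | hv
  · simpa using heq.self_of_nhds
  have hkey : ∀ z₀ : ℂ, Complex.exp (-z₀) = v → expOrbitIntegral T z₀ (h v) = 0 := by
    intro z₀ hz₀
    have hcont : ContinuousAt (fun z : ℂ => Complex.exp (-z)) z₀ := by fun_prop
    have hev := hcont.eventually (hz₀ ▸ hh.eventually_analyticAt.and heq)
    obtain ⟨r, hr, hball⟩ := Metric.eventually_nhds_iff_ball.1 hev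
    have hy : AnalyticOnNhd ℂ (fun z : ℂ => h (Complex.exp (-z))) (ball z₀ r) := fun z hz =>
      AnalyticAt.fun_comp (hball z hz).1 (by fun_prop)
    have h0 := hSVEP z₀ r hr (fun z => expOrbitIntegral T z (h (Complex.exp (-z))))
      (hT.analyticOnNhd_expOrbitIntegral isOpen_ball hy) (fun z hz => by
        obtain ⟨h1, h2⟩ := hA.mem_and_eq_smul fun t ht =>
          hT.map_expOrbitIntegral (hball z hz).2.symm ht
        exact ⟨h1, by rw [h2, sub_self]⟩) z₀ (mem_ball_self hr)
    simpa only [hz₀] using h0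
  set z₀ := -Complex.log v
  have hz₀ : Complex.exp (-z₀) = v := by rw [neg_neg, Complex.exp_log hv]
  have hzero := eq_zero_of_fourier_integrals_eq_zero
    (φ := fun s : ℝ => Complex.exp (-z₀ * s) • T s (h v))
    ((hT.continuousOn_exp_smul z₀ (h v)).mono Set.Icc_subset_Ici_self) (by
      have := heq.self_of_nhds
      simpa [hT.map_zero, hz₀] using this) (fun n => by
      have := hkey (z₀ - n * (2 * Real.pi * Complex.I)) (by
        rw [neg_sub, sub_eq_add_neg, add_comm, ← hz₀, Complex.exp_add,
          Complex.exp_int_mul_two_pi_mul_I, mul_one])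
      rw [← this, expOrbitIntegral]
      refine intervalIntegral.integral_congr fun s _ => ?_
      simp only [smul_smul, ← Complex.exp_add]
      congr 2
      ring)
  simpa [hT.map_zero] using hzero

end Semigroup

/-- If `‖T(t)x‖/t → 0` as `t → ∞`, `A` has the SVEP, and the local spectral radius of
`T(t)` at `x` is `< 1` for every `t > 0`, then `T(t)` is local mean ergodic at `x`,
with `C(t)x → 0`. -/
theorem localMeanErgodic_of_localSpectralRadius_lt_one
    {X : Type*} [NormedAddCommGroup X] [NormedSpace ℂ X] [CompleteSpace X]
    (T : ℝ → X →L[ℂ] X) (D : Set X) (A : X → X)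
    (hT : IsC0Semigroup T) (hA : IsGenerator T D A) (x : X)
    (hx : Tendsto (fun t : ℝ => ‖T t x‖ / t) atTop (𝓝 0))
    (hSVEP : ∀ μ : ℂ, HasSVEPAt D A μ)
    (hrad : ∀ t : ℝ, 0 < t →
      localSpectralRadius (Set.univ : Set X) (fun v => T t v) x < 1) :
    Tendsto (fun t : ℝ => cesaro T t x) atTop (𝓝 0) := by
  have hsum := summable_pow_apply_of_localSpectralRadius_lt_one (T 1) x (hrad 1 one_pos)
    (hT.eq_zero_of_eventually_eq_smul hA hSVEP)
  exact tendsto_inv_smul_integral_of_tendsto_zero (hT.strong_continuity x)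
    (hT.tendsto_of_tendsto_pow hsum.tendsto_atTop_zero)
end
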